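/- On $\mathbb{R}^{2n}$ the canonical Poisson bracket $\{q_i, p_j\}_0 = \delta_{ij}$ (all other coordinate brackets zero) and the second Toda bracket $\{\cdot,\cdot\}_1$ (given by $\{q_i,q_j\}_1 = -1$ for $i<j$, $\{q_i,p_j\}_1 = p_i\delta_{ij}$, $\{p_j,p_i\}_1 = e^{q_i-q_{i+1}}\delta_{j,i+1}$) are compatible: their sum $\{\cdot,\cdot\}_0 + \{\cdot,\cdot\}_1$ again satisfies the Jacobi identity. -/

import Mathlib

open scoped BigOperators

/-- Phase space `ℝ^{2n}` with coordinates `(q, p)`. -/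
abbrev TodaPt (n : ℕ) := (Fin n → ℝ) × (Fin n → ℝ)

/-- Partial derivative with respect to `q i`. -/
noncomputable def dq {n : ℕ} (f : TodaPt n → ℝ) (i : Fin n) (z : TodaPt n) : ℝ :=
  fderiv ℝ f z (Pi.single i 1, 0)

/-- Partial derivative with respect to `p i`. -/
noncomputable def dp {n : ℕ} (f : TodaPt n → ℝ) (i : Fin n) (z : TodaPt n) : ℝ :=
  fderiv ℝ f z (0, Pi.single i 1)

/-- The second Toda bracket on `ℝ^{2n}` in physical coordinates, determined by
`{q i, q j}₁ = -1` for `i < j`, `{q i, p i}₁ = p i`, and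
`{p (i+1), p i}₁ = exp (q i - q (i+1))`. -/
noncomputable def todaBr1 {n : ℕ} (f g : TodaPt n → ℝ) (z : TodaPt n) : ℝ :=
  (∑ i : Fin n, ∑ j : Fin n, if i < j then
      (-1 : ℝ) * (dq f i z * dq g j z - dq g i z * dq f j z) else 0)
  + (∑ i : Fin n, z.2 i * (dq f i z * dp g i z - dq g i z * dp f i z))
  + (∑ i : Fin n, ∑ j : Fin n, if (j : ℕ) = (i : ℕ) + 1 then
      Real.exp (z.1 i - z.1 j) * (dp f j z * dp g i z - dp g j z * dp f i z) else 0)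

/-- The canonical symplectic bracket on `ℝ^{2n}`: `{q i, p j}₀ = δ i j`. -/
noncomputable def todaBr0 {n : ℕ} (f g : TodaPt n → ℝ) (z : TodaPt n) : ℝ :=
  ∑ i : Fin n, (dq f i z * dp g i z - dq g i z * dp f i z)

section Bivector

variable {ι E : Type*} [Fintype ι] [NormedAddCommGroup E] [NormedSpace ℝ E]

/-- The bracket `{f, g} = ∑ a b, B a b * ∂ₐ f * ∂_b g` of a bivector with coefficients `B` in the
directions `e`. -/
noncomputable def bivectorBracket (B : ι → ι → E → ℝ) (e : ι → E) (f g : E → ℝ) (z : E) : ℝ :=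
  ∑ a, ∑ b, B a b z * fderiv ℝ f z (e a) * fderiv ℝ g z (e b)

/-- The Hamiltonian vector field of `f`, characterised by `{g, f} = dg (X_f)`. -/
noncomputable def hamiltonianField (B : ι → ι → E → ℝ) (e : ι → E) (f : E → ℝ) (z : E) : E :=
  ∑ a, ∑ b, (B a b z * fderiv ℝ f z (e b)) • e a

variable {B : ι → ι → E → ℝ} {e : ι → E}

theorem apply_hamiltonianField (L : E →L[ℝ] ℝ) (f : E → ℝ) (z : E) :
    L (hamiltonianField B e f z) = ∑ a, ∑ b, B a b z * L (e a) * fderiv ℝ f z (e b) := by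
  simp only [hamiltonianField, map_sum, map_smul, smul_eq_mul]
  exact Finset.sum_congr rfl fun a _ => Finset.sum_congr rfl fun b _ => by ring

theorem apply_hamiltonianField_of_antisymm (hB : ∀ a b z, B a b z = -B b a z)
    (L : E →L[ℝ] ℝ) (f : E → ℝ) (z : E) :
    ∑ a, ∑ b, B a b z * fderiv ℝ f z (e a) * L (e b) = -L (hamiltonianField B e f z) := by
  rw [apply_hamiltonianField, Finset.sum_comm, ← Finset.sum_neg_distrib]
  refine Finset.sum_congr rfl fun a _ => ?_
  rw [← Finset.sum_neg_distrib]
  refine Finset.sum_congr rfl fun b _ => ?_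
  rw [hB b a]
  ring

theorem fderiv_bivectorBracket (hB : ∀ a b z, B a b z = -B b a z)
    {B' : ι → ι → E → E →L[ℝ] ℝ} (hB' : ∀ a b z, HasFDerivAt (B a b) (B' a b z) z)
    {f g : E → ℝ} (hf : ContDiff ℝ 2 f) (hg : ContDiff ℝ 2 g) (z v : E) :
    fderiv ℝ (bivectorBracket B e f g) z v =
      (∑ a, ∑ b, B' a b z v * fderiv ℝ f z (e a) * fderiv ℝ g z (e b))
        + fderiv ℝ (fderiv ℝ f) z v (hamiltonianField B e g z)
        - fderiv ℝ (fderiv ℝ g) z v (hamiltonianField B e f z) := by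
  have partial_deriv : ∀ {k : E → ℝ}, ContDiff ℝ 2 k → ∀ a,
      HasFDerivAt (fun y => fderiv ℝ k y (e a)) ((fderiv ℝ (fderiv ℝ k) z).flip (e a)) z := by
    intro k hk a
    have hd : DifferentiableAt ℝ (fderiv ℝ k) z :=
      (hk.fderiv_right (m := 1) (by norm_num)).differentiable (by norm_num) z
    simpa using hd.hasFDerivAt.clm_apply (hasFDerivAt_const (e a) z)
  have key := HasFDerivAt.fun_sum (u := Finset.univ) fun a _ =>
    HasFDerivAt.fun_sum (u := Finset.univ) fun b _ =>
      ((hB' a b z).fun_mul (partial_deriv hf a)).fun_mul (partial_deriv hg b)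
  have heq : bivectorBracket B e f g = fun y => ∑ a, ∑ b,
      B a b y * fderiv ℝ f y (e a) * fderiv ℝ g y (e b) := rfl
  rw [heq, HasFDerivAt.fderiv key, apply_hamiltonianField, sub_eq_add_neg,
    ← apply_hamiltonianField_of_antisymm hB]
  simp only [← Finset.sum_add_distrib, sum_apply]
  refine Finset.sum_congr rfl fun a _ => Finset.sum_congr rfl fun b _ => ?_
  simp
  ring

theorem bivectorBracket_jacobi (hB : ∀ a b z, B a b z = -B b a z)
    {B' : ι → ι → E → E →L[ℝ] ℝ} (hB' : ∀ a b z, HasFDerivAt (B a b) (B' a b z) z)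
    (hJ : ∀ a b c z, ∑ d, B d c z * B' a b z (e d) + ∑ d, B d a z * B' b c z (e d)
      + ∑ d, B d b z * B' c a z (e d) = 0)
    {f g h : E → ℝ} (hf : ContDiff ℝ 2 f) (hg : ContDiff ℝ 2 g) (hh : ContDiff ℝ 2 h) (z : E) :
    bivectorBracket B e (bivectorBracket B e f g) h z
      + bivectorBracket B e (bivectorBracket B e g h) f z
      + bivectorBracket B e (bivectorBracket B e h f) g z = 0 := by
  have outer : ∀ k l : E → ℝ,
      bivectorBracket B e k l z = fderiv ℝ k z (hamiltonianField B e l z) := fun k l =>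
    (apply_hamiltonianField _ _ _).symm
  have symm : ∀ {k : E → ℝ}, ContDiff ℝ 2 k → ∀ v w,
      fderiv ℝ (fderiv ℝ k) z v w = fderiv ℝ (fderiv ℝ k) z w v := fun hk v w =>
    (hk.contDiffAt.isSymmSndFDerivAt (by simp)) v w
  have expand : ∀ k l m : E → ℝ,
      ∑ a, ∑ b, B' a b z (hamiltonianField B e m z) * fderiv ℝ k z (e a) * fderiv ℝ l z (e b)
        = ∑ a, ∑ b, ∑ c, (∑ d, B d c z * B' a b z (e d)) *
          (fderiv ℝ k z (e a) * fderiv ℝ l z (e b) * fderiv ℝ m z (e c)) := by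
    intro k l m
    refine Finset.sum_congr rfl fun a _ => Finset.sum_congr rfl fun b _ => ?_
    rw [apply_hamiltonianField, Finset.sum_comm, Finset.sum_mul, Finset.sum_mul]
    refine Finset.sum_congr rfl fun c _ => ?_
    simp only [Finset.sum_mul]
    exact Finset.sum_congr rfl fun d _ => by ring
  have rotate : ∀ F : ι → ι → ι → ℝ, ∑ a, ∑ b, ∑ c, F a b c = ∑ a, ∑ b, ∑ c, F b c a := by
    intro F
    rw [Finset.sum_congr rfl fun a _ => Finset.sum_comm, Finset.sum_comm]
  have first_order :
      ∑ a, ∑ b, B' a b z (hamiltonianField B e h z) * fderiv ℝ f z (e a) * fderiv ℝ g z (e b)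
      + ∑ a, ∑ b, B' a b z (hamiltonianField B e f z) * fderiv ℝ g z (e a) * fderiv ℝ h z (e b)
      + ∑ a, ∑ b, B' a b z (hamiltonianField B e g z) * fderiv ℝ h z (e a) * fderiv ℝ f z (e b)
      = 0 := by
    rw [expand f g h, (expand g h f).trans (rotate _),
      ((expand h f g).trans (rotate _)).trans (rotate _)]
    simp only [← Finset.sum_add_distrib]
    refine Finset.sum_eq_zero fun a _ => Finset.sum_eq_zero fun b _ =>
      Finset.sum_eq_zero fun c _ => ?_
    linear_combination
      (fderiv ℝ f z (e a) * fderiv ℝ g z (e b) * fderiv ℝ h z (e c)) * hJ a b c z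
  rw [outer, outer, outer, fderiv_bivectorBracket hB hB' hf hg,
    fderiv_bivectorBracket hB hB' hg hh, fderiv_bivectorBracket hB hB' hh hf,
    symm hf (hamiltonianField B e h z), symm hg (hamiltonianField B e h z),
    symm hh (hamiltonianField B e g z)]
  linear_combination first_order

end Bivector

/-- The coordinate directions of phase space: `Sum.inl i` for `q i` and `Sum.inr i` for `p i`. -/
noncomputable def todaDir {n : ℕ} : Fin n ⊕ Fin n → TodaPt n
  | .inl i => (Pi.single i 1, 0)
  | .inr i => (0, Pi.single i 1)

/-- The coefficients of the sum of the canonical and the second Toda bivector. -/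
noncomputable def todaCoeff {n : ℕ} : Fin n ⊕ Fin n → Fin n ⊕ Fin n → TodaPt n → ℝ
  | .inl i, .inl j, _ => (if j < i then 1 else 0) - if i < j then 1 else 0
  | .inl i, .inr j, z => if i = j then z.2 i + 1 else 0
  | .inr i, .inl j, z => if i = j then -(z.2 i + 1) else 0
  | .inr i, .inr j, z =>
    (if (i : ℕ) = j + 1 then Real.exp (z.1 j - z.1 i) else 0)
      - if (j : ℕ) = i + 1 then Real.exp (z.1 i - z.1 j) else 0

/-- The coordinate `q i` as a linear form. -/
noncomputable def todaQ {n : ℕ} (i : Fin n) : TodaPt n →L[ℝ] ℝ :=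
  (ContinuousLinearMap.proj (R := ℝ) (φ := fun _ : Fin n => ℝ) i).comp
    (ContinuousLinearMap.fst ℝ _ _)

/-- The coordinate `p i` as a linear form. -/
noncomputable def todaP {n : ℕ} (i : Fin n) : TodaPt n →L[ℝ] ℝ :=
  (ContinuousLinearMap.proj (R := ℝ) (φ := fun _ : Fin n => ℝ) i).comp
    (ContinuousLinearMap.snd ℝ _ _)

/-- The differentials of the coefficients `todaCoeff`. -/
noncomputable def todaCoeffDeriv {n : ℕ} :
    Fin n ⊕ Fin n → Fin n ⊕ Fin n → TodaPt n → TodaPt n →L[ℝ] ℝ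
  | .inl _, .inl _, _ => 0
  | .inl i, .inr j, _ => if i = j then todaP i else 0
  | .inr i, .inl j, _ => if i = j then -todaP i else 0
  | .inr i, .inr j, z =>
    ((if (i : ℕ) = j + 1 then Real.exp (z.1 j - z.1 i) else 0)
      + if (j : ℕ) = i + 1 then Real.exp (z.1 i - z.1 j) else 0) • (todaQ j - todaQ i)

theorem todaCoeff_antisymm {n : ℕ} (a b : Fin n ⊕ Fin n) (z : TodaPt n) :
    todaCoeff a b z = -todaCoeff b a z := by
  rcases a with i | i <;> rcases b with j | j <;> simp only [todaCoeff] <;> grind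

theorem hasFDerivAt_todaCoeff {n : ℕ} (a b : Fin n ⊕ Fin n) (z : TodaPt n) :
    HasFDerivAt (todaCoeff a b) (todaCoeffDeriv a b z) z := by
  have hq : ∀ i, HasFDerivAt (fun y : TodaPt n => y.1 i) (todaQ i) z := fun i =>
    (todaQ i).hasFDerivAt
  have hp : ∀ i, HasFDerivAt (fun y : TodaPt n => y.2 i) (todaP i) z := fun i =>
    (todaP i).hasFDerivAt
  rcases a with i | i <;> rcases b with j | j
  · exact hasFDerivAt_const _ z
  · unfold todaCoeff todaCoeffDeriv
    by_cases hij : i = j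
    · simpa only [if_pos hij] using (hp i).add_const 1
    · simpa only [if_neg hij] using hasFDerivAt_const (0 : ℝ) z
  · unfold todaCoeff todaCoeffDeriv
    by_cases hij : i = j
    · simpa only [if_pos hij] using ((hp i).add_const 1).fun_neg
    · simpa only [if_neg hij] using hasFDerivAt_const (0 : ℝ) z
  · unfold todaCoeff todaCoeffDeriv
    by_cases hij : (i : ℕ) = j + 1
    · have hji : ¬(j : ℕ) = i + 1 := by omega
      simpa only [if_pos hij, if_neg hji, sub_zero, add_zero] using
        ((hq j).fun_sub (hq i)).exp
    · by_cases hji : (j : ℕ) = i + 1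
      · simp only [if_neg hij, if_pos hji, zero_sub, zero_add]
        refine ((hq i).fun_sub (hq j)).exp.fun_neg.congr_fderiv ?_
        rw [← smul_neg, neg_sub]
      · simpa only [if_neg hij, if_neg hji, sub_zero, add_zero, zero_smul] using
          hasFDerivAt_const (0 : ℝ) z

theorem sum_todaCoeff_mul_todaCoeffDeriv {n : ℕ} (a b c : Fin n ⊕ Fin n) (z : TodaPt n) :
    ∑ d, todaCoeff d c z * todaCoeffDeriv a b z (todaDir d) =
      match a, b with
      | .inl _, .inl _ => 0
      | .inl i, .inr j => if i = j then todaCoeff (.inr i) c z else 0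
      | .inr i, .inl j => if i = j then -todaCoeff (.inr i) c z else 0
      | .inr i, .inr j =>
        ((if (i : ℕ) = j + 1 then Real.exp (z.1 j - z.1 i) else 0)
          + if (j : ℕ) = i + 1 then Real.exp (z.1 i - z.1 j) else 0) *
        (todaCoeff (.inl j) c z - todaCoeff (.inl i) c z) := by
  rcases a with i | i <;> rcases b with j | j
  · simp [todaCoeffDeriv]
  · by_cases hij : i = j <;>
      simp [todaCoeffDeriv, todaDir, todaP, hij, Pi.single_apply]
  · by_cases hij : i = j <;>
      simp [todaCoeffDeriv, todaDir, todaP, hij, Pi.single_apply]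
  · simp [todaCoeffDeriv, todaDir, todaQ, Pi.single_apply, mul_sub, Finset.sum_sub_distrib]
    ring

theorem todaCoeff_jacobi {n : ℕ} (a b c : Fin n ⊕ Fin n) (z : TodaPt n) :
    ∑ d, todaCoeff d c z * todaCoeffDeriv a b z (todaDir d)
      + ∑ d, todaCoeff d a z * todaCoeffDeriv b c z (todaDir d)
      + ∑ d, todaCoeff d b z * todaCoeffDeriv c a z (todaDir d) = 0 := by
  simp only [sum_todaCoeff_mul_todaCoeffDeriv]
  rcases a with i | i <;> rcases b with j | j <;> rcases c with k | k <;>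
    simp only [todaCoeff]
  all_goals grind

theorem todaBr0_add_todaBr1_eq_bivectorBracket {n : ℕ} (f g : TodaPt n → ℝ) (z : TodaPt n) :
    todaBr0 f g z + todaBr1 f g z = bivectorBracket todaCoeff todaDir f g z := by
  have hqq : (∑ i, ∑ j, if i < j then
        (-1 : ℝ) * (dq f i z * dq g j z - dq g i z * dq f j z) else 0)
      = ∑ i, ∑ j, ((if j < i then (1 : ℝ) else 0) - if i < j then 1 else 0)
        * dq f i z * dq g j z := by
    simp only [sub_mul, Finset.sum_sub_distrib]
    rw [Finset.sum_comm (f := fun i j => (if j < i then (1 : ℝ) else 0) * dq f i z * dq g j z)]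
    simp only [← Finset.sum_sub_distrib]
    refine Finset.sum_congr rfl fun i _ => Finset.sum_congr rfl fun j _ => ?_
    split_ifs <;> ring
  have hpp : (∑ i : Fin n, ∑ j : Fin n, if (j : ℕ) = (i : ℕ) + 1 then
        Real.exp (z.1 i - z.1 j) * (dp f j z * dp g i z - dp g j z * dp f i z) else 0)
      = ∑ i : Fin n, ∑ j : Fin n, ((if (i : ℕ) = j + 1 then Real.exp (z.1 j - z.1 i) else 0)
        - if (j : ℕ) = i + 1 then Real.exp (z.1 i - z.1 j) else 0) * dp f i z * dp g j z := by
    simp only [sub_mul, Finset.sum_sub_distrib]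
    rw [Finset.sum_comm (f := fun i j : Fin n =>
      (if (i : ℕ) = j + 1 then Real.exp (z.1 j - z.1 i) else 0) * dp f i z * dp g j z)]
    simp only [← Finset.sum_sub_distrib]
    refine Finset.sum_congr rfl fun i _ => Finset.sum_congr rfl fun j _ => ?_
    split_ifs <;> ring
  have hb : bivectorBracket todaCoeff todaDir f g z
      = ∑ i, (∑ j, todaCoeff (.inl i) (.inl j) z * dq f i z * dq g j z
          + ∑ j, todaCoeff (.inl i) (.inr j) z * dq f i z * dp g j z)
        + ∑ i, (∑ j, todaCoeff (.inr i) (.inl j) z * dp f i z * dq g j z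
          + ∑ j, todaCoeff (.inr i) (.inr j) z * dp f i z * dp g j z) := by
    simp only [bivectorBracket, Fintype.sum_sum_type]
    rfl
  rw [hb, todaBr0, todaBr1, hqq, hpp]
  simp only [todaCoeff, Finset.sum_add_distrib, ite_mul, zero_mul, Finset.sum_ite_eq,
    Finset.mem_univ, if_true]
  have hqp : ∑ i, (dq f i z * dp g i z - dq g i z * dp f i z)
      + ∑ i, z.2 i * (dq f i z * dp g i z - dq g i z * dp f i z)
      = ∑ i, (z.2 i + 1) * dq f i z * dp g i z + ∑ i, -(z.2 i + 1) * dp f i z * dq g i z := by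
    simp only [← Finset.sum_add_distrib]
    exact Finset.sum_congr rfl fun i _ => by ring
  linear_combination hqp

/-- The canonical bracket and the second Toda bracket are compatible: their sum
again satisfies the Jacobi identity. -/
theorem toda_brackets_compatible {n : ℕ} (f g h : TodaPt n → ℝ)
    (hf : ContDiff ℝ (⊤ : ℕ∞) f) (hg : ContDiff ℝ (⊤ : ℕ∞) g) (hh : ContDiff ℝ (⊤ : ℕ∞) h) :
    ∀ z : TodaPt n,
      (fun u v w => todaBr0 u v w + todaBr1 u v w)
          ((fun u v w => todaBr0 u v w + todaBr1 u v w) f g) h z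
      + (fun u v w => todaBr0 u v w + todaBr1 u v w)
          ((fun u v w => todaBr0 u v w + todaBr1 u v w) g h) f z
      + (fun u v w => todaBr0 u v w + todaBr1 u v w)
          ((fun u v w => todaBr0 u v w + todaBr1 u v w) h f) g z = 0 := by
  intro z
  simp only [todaBr0_add_todaBr1_eq_bivectorBracket]
  have two_le : ((2 : ℕ∞) : WithTop ℕ∞) ≤ ((⊤ : ℕ∞) : WithTop ℕ∞) := mod_cast le_top
  exact bivectorBracket_jacobi todaCoeff_antisymm hasFDerivAt_todaCoeff todaCoeff_jacobi
    (hf.of_le two_le) (hg.of_le two_le) (hh.of_le two_le) z
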